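/- Let E be a finite-dimensional spectral COSEA with norm ‖b‖=M(b). Then: (i) ‖b‖=max{ω(b) : ω∈Ω(E)}; (ii) if b_1⊥b_2 then ‖b_1⊕b_2‖≤‖b_1‖+‖b_2‖; (iii) ‖b‖=0 if and only if b=0; (iv) if a≤b then ‖a‖≤‖b‖, and a≤‖a‖·1 for all a∈E; (v) ‖a∘b‖≤‖a‖·‖b‖ for all a,b∈E. -/

import Mathlib

set_option linter.unusedVariables false

universe u v

theorem prod_eq' {α β : Type*} {p q : α × β} (h1 : p.1 = q.1) (h2 : p.2 = q.2) : p = q :=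
  Prod.ext_iff.mpr ⟨h1, h2⟩

/-- A convex sequential effect algebra (COSEA).  The partial sum `⊕` is modelled by a
total operation `oplus` together with a definedness predicate `perp`; all axioms only
constrain `oplus` on pairs satisfying `perp`.  The scalar action is modelled by a total
map `smul : ℝ → E → E`, with axioms imposed for scalars in `[0,1]`. -/
structure COSEA (E : Type u) where
  zero : E
  one : E
  perp : E → E → Prop
  oplus : E → E → E
  compl : E → E
  smul : ℝ → E → E
  seq : E → E → E
  -- effect algebra axioms
  perp_comm : ∀ a b, perp a b → perp b a
  oplus_comm : ∀ a b, perp a b → oplus a b = oplus b a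
  perp_assoc_right : ∀ a b c, perp a b → perp (oplus a b) c → perp b c
  perp_assoc_left : ∀ a b c, perp a b → perp (oplus a b) c → perp a (oplus b c)
  oplus_assoc : ∀ a b c, perp a b → perp (oplus a b) c →
    oplus a (oplus b c) = oplus (oplus a b) c
  perp_compl : ∀ a, perp a (compl a)
  oplus_compl : ∀ a, oplus a (compl a) = one
  compl_unique : ∀ a b, perp a b → oplus a b = one → b = compl a
  perp_one : ∀ a, perp a one → a = zero
  -- convexity axioms
  smul_smul : ∀ α β a, 0 ≤ α → α ≤ 1 → 0 ≤ β → β ≤ 1 →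
    smul α (smul β a) = smul (α * β) a
  perp_smul_self : ∀ α β a, 0 ≤ α → 0 ≤ β → α + β ≤ 1 → perp (smul α a) (smul β a)
  add_smul : ∀ α β a, 0 ≤ α → 0 ≤ β → α + β ≤ 1 →
    smul (α + β) a = oplus (smul α a) (smul β a)
  perp_smul : ∀ lam a b, 0 ≤ lam → lam ≤ 1 → perp a b → perp (smul lam a) (smul lam b)
  smul_oplus : ∀ lam a b, 0 ≤ lam → lam ≤ 1 → perp a b →
    smul lam (oplus a b) = oplus (smul lam a) (smul lam b)
  one_smul : ∀ a, smul 1 a = a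
  -- sequential product axioms
  seq_perp : ∀ a b c, perp b c → perp (seq a b) (seq a c)
  seq_oplus : ∀ a b c, perp b c → seq a (oplus b c) = oplus (seq a b) (seq a c)
  one_seq : ∀ a, seq one a = a
  seq_eq_zero_comm : ∀ a b, seq a b = zero → seq b a = seq a b
  comm_compl : ∀ a b, seq a b = seq b a → seq a (compl b) = seq (compl b) a
  comm_assoc : ∀ a b c, seq a b = seq b a → seq a (seq b c) = seq (seq a b) c
  comm_seq : ∀ a b c, seq c a = seq a c → seq c b = seq b c →
    seq c (seq a b) = seq (seq a b) c
  comm_oplus : ∀ a b c, seq c a = seq a c → seq c b = seq b c → perp a b →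
    seq c (oplus a b) = seq (oplus a b) c
  smul_seq : ∀ lam a b, 0 ≤ lam → lam ≤ 1 → seq (smul lam a) b = smul lam (seq a b)
  seq_smul : ∀ lam a b, 0 ≤ lam → lam ≤ 1 → seq a (smul lam b) = smul lam (seq a b)

/-- `SumList C l s` : the orthogonal sum of the list `l` is defined and equals `s`. -/
inductive COSEA.SumList {E : Type u} (C : COSEA E) : List E → E → Prop
  | nil : COSEA.SumList C [] C.zero
  | cons {a : E} {l : List E} {s : E} :
      COSEA.SumList C l s → C.perp a s → COSEA.SumList C (a :: l) (C.oplus a s)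

namespace COSEA

variable {E : Type u}

/-- `a ≤ b` in the effect-algebra order. -/
def le (C : COSEA E) (a b : E) : Prop := ∃ c, C.perp a c ∧ C.oplus a c = b

/-- `a` is sharp: the greatest lower bound of `a` and `a'` is `0`,
i.e. every common lower bound of `a` and `a'` lies below `0`. -/
def IsSharp (C : COSEA E) (a : E) : Prop :=
  ∀ c, C.le c a → C.le c (C.compl a) → C.le c C.zero

/-- `a` is a one-dimensional (atomic) sharp element. -/
def IsOneDim (C : COSEA E) (a : E) : Prop :=
  C.IsSharp a ∧ a ≠ C.zero ∧
    ∀ b, C.le b a → ∃ lam : ℝ, 0 ≤ lam ∧ lam ≤ 1 ∧ b = C.smul lam a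

/-- A state on a COSEA. -/
def IsState (C : COSEA E) (ω : E → ℝ) : Prop :=
  (∀ a, 0 ≤ ω a ∧ ω a ≤ 1) ∧ ω C.one = 1 ∧
    ∀ a b, C.perp a b → ω (C.oplus a b) = ω a + ω b

/-- A context presented as an injective finite enumeration of one-dimensional
elements summing to `1`. -/
def IsContextFun (C : COSEA E) {n : ℕ} (a : Fin n → E) : Prop :=
  Function.Injective a ∧ (∀ i, C.IsOneDim (a i)) ∧ C.SumList (List.ofFn a) C.one

/-- A context as a set of effects. -/
def IsContext (C : COSEA E) (A : Set E) : Prop :=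
  ∃ (n : ℕ) (a : Fin n → E), C.IsContextFun a ∧ Set.range a = A

/-- `E` is finite-dimensional: there is no infinite sequence of one-dimensional
elements all of whose initial partial orthogonal sums are defined. -/
def FinDim (C : COSEA E) : Prop :=
  ¬ ∃ f : ℕ → E, (∀ i, C.IsOneDim (f i)) ∧
      ∀ n : ℕ, ∃ s, C.SumList ((List.range n).map f) s

/-- `E` is state-unique. -/
def StateUnique (C : COSEA E) : Prop :=
  ∀ a, C.IsOneDim a → ∃! ω : E → ℝ, C.IsState ω ∧ ω a = 1

/-- `E` is symmetric : `â(b) = b̂(a)` for all one-dimensional `a, b`. -/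
def Symm (C : COSEA E) : Prop :=
  ∀ a b ω ρ, C.IsOneDim a → C.IsOneDim b → C.IsState ω → C.IsState ρ →
    ω a = 1 → ρ b = 1 → ω b = ρ a

/-- `b = λ₁ a₁ ⊕ ⋯ ⊕ λₙ aₙ` with all `λ i ∈ [0,1]`. -/
def SpanRep (C : COSEA E) {n : ℕ} (a : Fin n → E) (lam : Fin n → ℝ) (b : E) : Prop :=
  (∀ i, 0 ≤ lam i ∧ lam i ≤ 1) ∧
    C.SumList (List.ofFn fun i => C.smul (lam i) (a i)) b

/-- `b ∈ E(A)` : `b` has a representation over the context `A`. -/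
def InSpan (C : COSEA E) (A : Set E) (b : E) : Prop :=
  ∃ (n : ℕ) (a : Fin n → E) (lam : Fin n → ℝ),
    C.IsContextFun a ∧ Set.range a = A ∧ C.SpanRep a lam b

/-- `E` is spectral. -/
def Spectral (C : COSEA E) : Prop :=
  C.StateUnique ∧ ∀ b, ∃ A, C.IsContext A ∧ C.InSpan A b

/-- The commutant of a subset. -/
def commutant (C : COSEA E) (F : Set E) : Set E :=
  {b | ∀ a ∈ F, C.seq b a = C.seq a b}

/-- The center `E' = {b : b ∘ a = a ∘ b for all a}`. -/
def center (C : COSEA E) : Set E := C.commutant Set.univ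

/-- `E` is a factor: the center consists of the effects `λ 1`, `λ ∈ [0,1]`. -/
def IsFactor (C : COSEA E) : Prop :=
  C.center = {b | ∃ lam : ℝ, 0 ≤ lam ∧ lam ≤ 1 ∧ b = C.smul lam C.one}

/-- Sub-COSEA. -/
def IsSubCOSEA (C : COSEA E) (F : Set E) : Prop :=
  C.zero ∈ F ∧ C.one ∈ F ∧ (∀ a ∈ F, C.compl a ∈ F) ∧
    (∀ lam : ℝ, 0 ≤ lam → lam ≤ 1 → ∀ a ∈ F, C.smul lam a ∈ F) ∧
    (∀ a ∈ F, ∀ b ∈ F, C.perp a b → C.oplus a b ∈ F) ∧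
    (∀ a ∈ F, ∀ b ∈ F, C.seq a b ∈ F)

/-- `a` is a minimal sharp element of `F`. -/
def MinSharp (C : COSEA E) (F : Set E) (a : E) : Prop :=
  a ∈ F ∧ C.IsSharp a ∧ a ≠ C.zero ∧
    ∀ b ∈ F, C.IsSharp b → b ≠ C.zero → C.le b a → b = a

/-- COSEA isomorphism. -/
def IsIso {F : Type u} (C : COSEA E) (D : COSEA F) (φ : E → F) : Prop :=
  Function.Bijective φ ∧ φ C.one = D.one ∧
    (∀ a b, C.perp a b ↔ D.perp (φ a) (φ b)) ∧
    (∀ a b, C.perp a b → φ (C.oplus a b) = D.oplus (φ a) (φ b)) ∧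
    (∀ lam : ℝ, 0 ≤ lam → lam ≤ 1 → ∀ a, φ (C.smul lam a) = D.smul lam (φ a)) ∧
    (∀ a b, φ (C.seq a b) = D.seq (φ a) (φ b))

/-- `lam` is an eigenvalue of `b` : `lam = â(b)` for some eigeneffect `a` of `b`. -/
def IsEigenvalue (C : COSEA E) (b : E) (lam : ℝ) : Prop :=
  ∃ (a : E) (ω : E → ℝ), C.IsOneDim a ∧ C.seq a b = C.seq b a ∧
    C.IsState ω ∧ ω a = 1 ∧ lam = ω b

/-- The spectrum of `b`. -/
def spectrum (C : COSEA E) (b : E) : Set ℝ := {lam | C.IsEigenvalue b lam}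

/-- `c = ⌈a⌉` : `c` is the least sharp element dominating `a`. -/
def IsCeil (C : COSEA E) (a c : E) : Prop :=
  C.IsSharp c ∧ C.le a c ∧ ∀ d, C.IsSharp d → C.le a d → C.le c d

/-- `b` is a pseudo-inverse of `a` with scalar `lam` :
`⌈b⌉ = ⌈a⌉`, `‖b‖ = 1` and `a ∘ b = b ∘ a = lam ⌈a⌉`. -/
def IsPseudoInvWith (C : COSEA E) (a b : E) (lam : ℝ) : Prop :=
  (∃ ca, C.IsCeil a ca ∧ C.IsCeil b ca ∧
    C.seq a b = C.smul lam ca ∧ C.seq b a = C.smul lam ca) ∧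
  IsGreatest (C.spectrum b) 1 ∧ 0 ≤ lam ∧ lam ≤ 1

/-- The conditional probability map `γ_a` (zero functionals are sent to `0`). -/
noncomputable def condProb (C : COSEA E) (a : E) (ω : E → ℝ) : E → ℝ :=
  fun c => if ω a = 0 then 0 else ω (C.seq a c) / ω a

/-- Membership in `Ω̂(E) = Ω(E) ∪ {0}`. -/
def InOmegaHat (C : COSEA E) (ω : E → ℝ) : Prop :=
  C.IsState ω ∨ ω = fun _ => 0

/-- Direct sum of two COSEAs, with all operations componentwise. -/
def prod {E F : Type u} (C : COSEA E) (D : COSEA F) : COSEA (E × F) where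
  zero := (C.zero, D.zero)
  one := (C.one, D.one)
  perp a b := C.perp a.1 b.1 ∧ D.perp a.2 b.2
  oplus a b := (C.oplus a.1 b.1, D.oplus a.2 b.2)
  compl a := (C.compl a.1, D.compl a.2)
  smul lam a := (C.smul lam a.1, D.smul lam a.2)
  seq a b := (C.seq a.1 b.1, D.seq a.2 b.2)
  perp_comm := fun a b h => ⟨C.perp_comm _ _ h.1, D.perp_comm _ _ h.2⟩
  oplus_comm := fun a b h => prod_eq' (C.oplus_comm _ _ h.1) (D.oplus_comm _ _ h.2)
  perp_assoc_right := fun a b c h1 h2 =>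
    ⟨C.perp_assoc_right _ _ _ h1.1 h2.1, D.perp_assoc_right _ _ _ h1.2 h2.2⟩
  perp_assoc_left := fun a b c h1 h2 =>
    ⟨C.perp_assoc_left _ _ _ h1.1 h2.1, D.perp_assoc_left _ _ _ h1.2 h2.2⟩
  oplus_assoc := fun a b c h1 h2 =>
    prod_eq' (C.oplus_assoc _ _ _ h1.1 h2.1) (D.oplus_assoc _ _ _ h1.2 h2.2)
  perp_compl := fun a => ⟨C.perp_compl _, D.perp_compl _⟩
  oplus_compl := fun a => prod_eq' (C.oplus_compl _) (D.oplus_compl _)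
  compl_unique := fun a b h he =>
    prod_eq' (C.compl_unique _ _ h.1 (congrArg Prod.fst he))
      (D.compl_unique _ _ h.2 (congrArg Prod.snd he))
  perp_one := fun a h => prod_eq' (C.perp_one _ h.1) (D.perp_one _ h.2)
  smul_smul := fun α β a h1 h2 h3 h4 =>
    prod_eq' (C.smul_smul _ _ _ h1 h2 h3 h4) (D.smul_smul _ _ _ h1 h2 h3 h4)
  perp_smul_self := fun α β a h1 h2 h3 =>
    ⟨C.perp_smul_self _ _ _ h1 h2 h3, D.perp_smul_self _ _ _ h1 h2 h3⟩
  add_smul := fun α β a h1 h2 h3 =>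
    prod_eq' (C.add_smul _ _ _ h1 h2 h3) (D.add_smul _ _ _ h1 h2 h3)
  perp_smul := fun lam a b h1 h2 h =>
    ⟨C.perp_smul _ _ _ h1 h2 h.1, D.perp_smul _ _ _ h1 h2 h.2⟩
  smul_oplus := fun lam a b h1 h2 h =>
    prod_eq' (C.smul_oplus _ _ _ h1 h2 h.1) (D.smul_oplus _ _ _ h1 h2 h.2)
  one_smul := fun a => prod_eq' (C.one_smul _) (D.one_smul _)
  seq_perp := fun a b c h => ⟨C.seq_perp _ _ _ h.1, D.seq_perp _ _ _ h.2⟩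
  seq_oplus := fun a b c h => prod_eq' (C.seq_oplus _ _ _ h.1) (D.seq_oplus _ _ _ h.2)
  one_seq := fun a => prod_eq' (C.one_seq _) (D.one_seq _)
  seq_eq_zero_comm := fun a b h =>
    prod_eq' (C.seq_eq_zero_comm _ _ (congrArg Prod.fst h))
      (D.seq_eq_zero_comm _ _ (congrArg Prod.snd h))
  comm_compl := fun a b h =>
    prod_eq' (C.comm_compl _ _ (congrArg Prod.fst h))
      (D.comm_compl _ _ (congrArg Prod.snd h))
  comm_assoc := fun a b c h =>
    prod_eq' (C.comm_assoc _ _ _ (congrArg Prod.fst h))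
      (D.comm_assoc _ _ _ (congrArg Prod.snd h))
  comm_seq := fun a b c h1 h2 =>
    prod_eq' (C.comm_seq _ _ _ (congrArg Prod.fst h1) (congrArg Prod.fst h2))
      (D.comm_seq _ _ _ (congrArg Prod.snd h1) (congrArg Prod.snd h2))
  comm_oplus := fun a b c h1 h2 hp =>
    prod_eq' (C.comm_oplus _ _ _ (congrArg Prod.fst h1) (congrArg Prod.fst h2) hp.1)
      (D.comm_oplus _ _ _ (congrArg Prod.snd h1) (congrArg Prod.snd h2) hp.2)
  smul_seq := fun lam a b h1 h2 =>
    prod_eq' (C.smul_seq _ _ _ h1 h2) (D.smul_seq _ _ _ h1 h2)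
  seq_smul := fun lam a b h1 h2 =>
    prod_eq' (C.seq_smul _ _ _ h1 h2) (D.seq_smul _ _ _ h1 h2)

/-- Direct sum of a family of COSEAs, with all operations componentwise. -/
def pi {ι : Type v} {E : ι → Type u} (C : ∀ i, COSEA (E i)) : COSEA (∀ i, E i) where
  zero := fun i => (C i).zero
  one := fun i => (C i).one
  perp a b := ∀ i, (C i).perp (a i) (b i)
  oplus a b := fun i => (C i).oplus (a i) (b i)
  compl a := fun i => (C i).compl (a i)
  smul lam a := fun i => (C i).smul lam (a i)
  seq a b := fun i => (C i).seq (a i) (b i)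
  perp_comm := fun a b h i => (C i).perp_comm _ _ (h i)
  oplus_comm := fun a b h => funext fun i => (C i).oplus_comm _ _ (h i)
  perp_assoc_right := fun a b c h1 h2 i => (C i).perp_assoc_right _ _ _ (h1 i) (h2 i)
  perp_assoc_left := fun a b c h1 h2 i => (C i).perp_assoc_left _ _ _ (h1 i) (h2 i)
  oplus_assoc := fun a b c h1 h2 => funext fun i => (C i).oplus_assoc _ _ _ (h1 i) (h2 i)
  perp_compl := fun a i => (C i).perp_compl _
  oplus_compl := fun a => funext fun i => (C i).oplus_compl _
  compl_unique := fun a b h he =>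
    funext fun i => (C i).compl_unique _ _ (h i) (congrFun he i)
  perp_one := fun a h => funext fun i => (C i).perp_one _ (h i)
  smul_smul := fun α β a h1 h2 h3 h4 =>
    funext fun i => (C i).smul_smul _ _ _ h1 h2 h3 h4
  perp_smul_self := fun α β a h1 h2 h3 i => (C i).perp_smul_self _ _ _ h1 h2 h3
  add_smul := fun α β a h1 h2 h3 => funext fun i => (C i).add_smul _ _ _ h1 h2 h3
  perp_smul := fun lam a b h1 h2 h i => (C i).perp_smul _ _ _ h1 h2 (h i)
  smul_oplus := fun lam a b h1 h2 h =>
    funext fun i => (C i).smul_oplus _ _ _ h1 h2 (h i)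
  one_smul := fun a => funext fun i => (C i).one_smul _
  seq_perp := fun a b c h i => (C i).seq_perp _ _ _ (h i)
  seq_oplus := fun a b c h => funext fun i => (C i).seq_oplus _ _ _ (h i)
  one_seq := fun a => funext fun i => (C i).one_seq _
  seq_eq_zero_comm := fun a b h =>
    funext fun i => (C i).seq_eq_zero_comm _ _ (congrFun h i)
  comm_compl := fun a b h => funext fun i => (C i).comm_compl _ _ (congrFun h i)
  comm_assoc := fun a b c h => funext fun i => (C i).comm_assoc _ _ _ (congrFun h i)
  comm_seq := fun a b c h1 h2 =>
    funext fun i => (C i).comm_seq _ _ _ (congrFun h1 i) (congrFun h2 i)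
  comm_oplus := fun a b c h1 h2 hp =>
    funext fun i => (C i).comm_oplus _ _ _ (congrFun h1 i) (congrFun h2 i) (hp i)
  smul_seq := fun lam a b h1 h2 => funext fun i => (C i).smul_seq _ _ _ h1 h2
  seq_smul := fun lam a b h1 h2 => funext fun i => (C i).seq_smul _ _ _ h1 h2

end COSEA

namespace COSEA

variable {E : Type u} (C : COSEA E)

/-! ### Effect algebra arithmetic -/

theorem compl_compl (a : E) : C.compl (C.compl a) = a :=
  (C.compl_unique _ _ (C.perp_comm _ _ (C.perp_compl a))
    ((C.oplus_comm _ _ (C.perp_compl a)).symm.trans (C.oplus_compl a))).symm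

theorem compl_one : C.compl C.one = C.zero :=
  C.perp_one _ (C.perp_comm _ _ (C.perp_compl C.one))

theorem compl_zero : C.compl C.zero = C.one := by
  rw [← C.compl_one, C.compl_compl]

theorem perp_zero (a : E) : C.perp a C.zero := by
  have h := C.perp_compl C.one
  rw [C.compl_one, ← C.oplus_compl (C.compl a), C.compl_compl] at h
  have hp := C.perp_compl (C.compl a)
  rw [C.compl_compl] at hp
  exact C.perp_assoc_right _ _ _ hp h

theorem oplus_zero (a : E) : C.oplus a C.zero = a := by
  have hp := C.perp_compl (C.compl a)
  have hs := C.oplus_compl (C.compl a)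
  have h1 := C.perp_compl C.one
  have h2 := C.oplus_compl C.one
  rw [C.compl_one] at h1 h2
  rw [C.compl_compl] at hp hs
  rw [← hs] at h1
  have h3 := C.oplus_assoc _ _ _ hp h1
  rw [hs, h2] at h3
  rw [C.compl_unique _ _ (C.perp_assoc_left _ _ _ hp h1) h3, C.compl_compl]

theorem oplus_left_cancel {a b c : E} (hb : C.perp a b) (hc : C.perp a c)
    (h : C.oplus a b = C.oplus a c) : b = c := by
  have key : ∀ x, C.perp a x →
      C.oplus a (C.compl (C.oplus a x)) = C.compl x := fun x hx => by
    have hx' := C.perp_comm _ _ hx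
    have hp := C.perp_compl (C.oplus x a)
    rw [C.oplus_comm _ _ hx]
    exact C.compl_unique _ _ (C.perp_assoc_left _ _ _ hx' hp)
      ((C.oplus_assoc _ _ _ hx' hp).trans (C.oplus_compl _))
  rw [← C.compl_compl b, ← key b hb, h, key c hc, C.compl_compl]

theorem le_compl_of_perp {a b : E} (h : C.perp a b) : C.le b (C.compl a) := by
  have hp := C.perp_compl (C.oplus a b)
  exact ⟨_, C.perp_assoc_right _ _ _ h hp,
    C.compl_unique _ _ (C.perp_assoc_left _ _ _ h hp)
      ((C.oplus_assoc _ _ _ h hp).trans (C.oplus_compl _))⟩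

theorem eq_zero_of_le_zero {a : E} (h : C.le a C.zero) : a = C.zero := by
  obtain ⟨c, hc, hs⟩ := h
  have hp := C.perp_comm _ _ (C.perp_zero C.one)
  rw [← hs] at hp
  have hc0 := C.perp_one _ (C.perp_assoc_right _ _ _ hc hp)
  rw [hc0, C.oplus_zero] at hs
  exact hs

theorem perp_of_perp_of_le {a b c : E} (h : C.perp a c) (hb : C.le b c) : C.perp a b := by
  obtain ⟨d, hd, rfl⟩ := hb
  rw [C.oplus_comm _ _ hd] at h
  exact C.perp_comm _ _
    (C.perp_assoc_right _ _ _ (C.perp_comm _ _ hd) (C.perp_comm _ _ h))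

theorem le_trans {a b c : E} (hab : C.le a b) (hbc : C.le b c) : C.le a c := by
  obtain ⟨d, hd, rfl⟩ := hab
  obtain ⟨e, he, rfl⟩ := hbc
  exact ⟨_, C.perp_assoc_left _ _ _ hd he, C.oplus_assoc _ _ _ hd he⟩

theorem le_oplus_left {a b : E} (h : C.perp a b) : C.le a (C.oplus a b) := ⟨b, h, rfl⟩

theorem le_oplus_right {a b : E} (h : C.perp a b) : C.le b (C.oplus a b) :=
  ⟨a, C.perp_comm _ _ h, (C.oplus_comm _ _ h).symm⟩

theorem oplus_le_oplus_left {a b c : E} (h : C.perp a c) (hb : C.le b c) :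
    C.le (C.oplus a b) (C.oplus a c) := by
  have hab := C.perp_of_perp_of_le h hb
  obtain ⟨d, hd, rfl⟩ := hb
  rw [C.oplus_comm _ _ hd] at h ⊢
  have hd' := C.perp_comm _ _ hd
  have h' := C.perp_comm _ _ h
  have hl := C.perp_assoc_left _ _ _ hd' h'
  have hs := C.oplus_assoc _ _ _ hd' h'
  rw [C.oplus_comm _ _ (C.perp_comm _ _ hab)] at hl hs
  exact ⟨d, C.perp_comm _ _ hl, by
    rw [← C.oplus_comm _ _ hl, hs, C.oplus_comm _ _ h']⟩

theorem oplus_le_oplus {a b c d : E} (h : C.perp b d) (hab : C.le a b) (hcd : C.le c d) :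
    C.perp a c ∧ C.le (C.oplus a c) (C.oplus b d) := by
  have hbc := C.perp_of_perp_of_le h hcd
  have hca := C.perp_of_perp_of_le (C.perp_comm _ _ hbc) hab
  refine ⟨C.perp_comm _ _ hca, C.le_trans ?_ (C.oplus_le_oplus_left h hcd)⟩
  rw [← C.oplus_comm _ _ hca, C.oplus_comm _ _ hbc]
  exact C.oplus_le_oplus_left (C.perp_comm _ _ hbc) hab

/-! ### Scalars -/

theorem zero_smul (a : E) : C.smul 0 a = C.zero := by
  have hp := C.perp_smul_self 0 0 a le_rfl le_rfl (by norm_num)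
  have hs := C.add_smul 0 0 a le_rfl le_rfl (by norm_num)
  rw [add_zero] at hs
  exact C.oplus_left_cancel hp (C.perp_zero _) (hs.symm.trans (C.oplus_zero _).symm)

theorem smul_le_smul {α β : ℝ} (a : E) (hα : 0 ≤ α) (hαβ : α ≤ β) (hβ : β ≤ 1) :
    C.le (C.smul α a) (C.smul β a) :=
  ⟨C.smul (β - α) a, C.perp_smul_self _ _ _ hα (sub_nonneg.2 hαβ) (by linarith), by
    rw [← C.add_smul _ _ _ hα (sub_nonneg.2 hαβ) (by linarith), add_sub_cancel]⟩

theorem smul_zero {lam : ℝ} (h0 : 0 ≤ lam) (h1 : lam ≤ 1) : C.smul lam C.zero = C.zero := by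
  rw [← C.zero_smul C.zero, C.smul_smul _ _ _ h0 h1 le_rfl zero_le_one, mul_zero]

/-! ### Sequential products -/

theorem seq_zero (a : E) : C.seq a C.zero = C.zero := by
  have hp := C.seq_perp a _ _ (C.perp_zero C.zero)
  have hs := C.seq_oplus a _ _ (C.perp_zero C.zero)
  rw [C.oplus_zero] at hs
  exact C.oplus_left_cancel hp (C.perp_zero _) (hs.symm.trans (C.oplus_zero _).symm)

theorem zero_seq (a : E) : C.seq C.zero a = C.zero :=
  (C.seq_eq_zero_comm _ _ (C.seq_zero a)).trans (C.seq_zero a)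

theorem seq_one (a : E) : C.seq a C.one = a := by
  have h := C.comm_compl a C.zero ((C.seq_zero a).trans (C.zero_seq a).symm)
  rwa [C.compl_zero, C.one_seq] at h

theorem seq_le_seq (a : E) {b c : E} (h : C.le b c) : C.le (C.seq a b) (C.seq a c) := by
  obtain ⟨d, hd, rfl⟩ := h
  exact ⟨_, C.seq_perp _ _ _ hd, (C.seq_oplus _ _ _ hd).symm⟩

theorem seq_le_left (a b : E) : C.le (C.seq a b) a := by
  have h := C.seq_le_seq a (b := b) (c := C.one) ⟨_, C.perp_compl b, C.oplus_compl b⟩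
  rwa [C.seq_one] at h

theorem IsSharp.seq_eq_zero {C : COSEA E} {a b : E} (ha : C.IsSharp a) (h : C.perp a b) :
    C.seq a b = C.zero := by
  have hle := C.seq_le_left (C.compl a) a
  rw [← C.comm_compl a a rfl] at hle
  have h0 := C.eq_zero_of_le_zero (ha _ (C.seq_le_left a (C.compl a)) hle)
  have hb := C.seq_le_seq a (C.le_compl_of_perp h)
  rw [h0] at hb
  exact C.eq_zero_of_le_zero hb

theorem IsSharp.seq_comm_of_perp {C : COSEA E} {a b : E} (ha : C.IsSharp a)
    (h : C.perp a b) : C.seq a b = C.seq b a :=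
  (C.seq_eq_zero_comm _ _ (ha.seq_eq_zero h)).symm

theorem seq_smul_comm {lam : ℝ} {a b : E} (h0 : 0 ≤ lam) (h1 : lam ≤ 1)
    (h : C.seq a b = C.seq b a) : C.seq a (C.smul lam b) = C.seq (C.smul lam b) a := by
  rw [C.seq_smul _ _ _ h0 h1, C.smul_seq _ _ _ h0 h1, h]

/-! ### Orthogonal sums of lists -/

namespace SumList

variable {C}

theorem unique {l : List E} {s t : E} (hs : C.SumList l s) (ht : C.SumList l t) : s = t := by
  induction hs generalizing t with
  | nil => cases ht; rfl
  | cons _ _ ih => cases ht with | cons h _ => rw [ih h]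

theorem mem_le {l : List E} {s x : E} (hs : C.SumList l s) (hx : x ∈ l) : C.le x s := by
  induction hs with
  | nil => simp at hx
  | cons _ hp ih =>
    rcases List.mem_cons.1 hx with rfl | hx
    · exact C.le_oplus_left hp
    · exact C.le_trans (ih hx) (C.le_oplus_right hp)

theorem pairwise_perp {l : List E} {s : E} (hs : C.SumList l s) : l.Pairwise C.perp := by
  induction hs with
  | nil => exact List.Pairwise.nil
  | cons h hp ih =>
    exact List.Pairwise.cons (fun x hx => C.perp_of_perp_of_le hp (h.mem_le hx)) ih

theorem map_smul {l : List E} {s : E} {lam : ℝ} (h0 : 0 ≤ lam) (h1 : lam ≤ 1)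
    (hs : C.SumList l s) : C.SumList (l.map (C.smul lam)) (C.smul lam s) := by
  induction hs with
  | nil => rw [C.smul_zero h0 h1]; exact SumList.nil
  | cons _ hp ih =>
    rw [C.smul_oplus _ _ _ h0 h1 hp]
    exact SumList.cons ih (C.perp_smul _ _ _ h0 h1 hp)

theorem exists_le {l m : List E} {t : E} (hlm : List.Forall₂ C.le l m) (ht : C.SumList m t) :
    ∃ s, C.SumList l s ∧ C.le s t := by
  induction hlm generalizing t with
  | nil => exact ⟨_, SumList.nil, by cases ht; exact ⟨_, C.perp_zero _, C.oplus_zero _⟩⟩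
  | cons hab _ ih =>
    cases ht with
    | cons ht hp =>
      obtain ⟨s, hs, hle⟩ := ih ht
      obtain ⟨hp', hle'⟩ := C.oplus_le_oplus hp hab hle
      exact ⟨_, SumList.cons hs hp', hle'⟩

theorem seq_comm {l : List E} {s c : E} (hs : C.SumList l s)
    (hc : ∀ x ∈ l, C.seq c x = C.seq x c) : C.seq c s = C.seq s c := by
  induction hs with
  | nil => rw [C.seq_zero, C.zero_seq]
  | cons _ hp ih =>
    exact C.comm_oplus _ _ _ (hc _ List.mem_cons_self)
      (ih fun x hx => hc x (List.mem_cons_of_mem _ hx)) hp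

end SumList

/-! ### States -/

namespace IsState

variable {C} {ω : E → ℝ}

theorem map_zero (hω : C.IsState ω) : ω C.zero = 0 := by
  have h := hω.2.2 _ _ (C.perp_zero C.zero)
  rw [C.oplus_zero] at h
  linarith

theorem mono (hω : C.IsState ω) {a b : E} (h : C.le a b) : ω a ≤ ω b := by
  obtain ⟨c, hc, rfl⟩ := h
  rw [hω.2.2 _ _ hc]
  linarith [(hω.1 c).1]

theorem add_le_one (hω : C.IsState ω) {a b : E} (h : C.perp a b) : ω a + ω b ≤ 1 :=
  hω.2.2 _ _ h ▸ (hω.1 _).2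

theorem map_sumList (hω : C.IsState ω) {l : List E} {s : E} (hs : C.SumList l s) :
    ω s = (l.map ω).sum := by
  induction hs with
  | nil => simpa using hω.map_zero
  | cons _ hp ih => rw [hω.2.2 _ _ hp, ih, List.map_cons, List.sum_cons]

theorem map_natCast_mul_smul (hω : C.IsState ω) (a : E) {t : ℝ} (ht : 0 ≤ t) (k : ℕ)
    (hk : k * t ≤ 1) : ω (C.smul (k * t) a) = k * ω (C.smul t a) := by
  induction k with
  | zero => simp [C.zero_smul, hω.map_zero]
  | succ k ih =>
    push_cast at hk ⊢
    have hkt : 0 ≤ k * t := by positivity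
    rw [add_mul, one_mul] at hk ⊢
    rw [C.add_smul _ _ _ hkt ht hk, hω.2.2 _ _ (C.perp_smul_self _ _ _ hkt ht hk),
      ih (by linarith)]
    ring

/-- States are homogeneous: additivity and monotonicity force linearity in the scalar. -/
theorem map_smul (hω : C.IsState ω) {lam : ℝ} (h0 : 0 ≤ lam) (h1 : lam ≤ 1) (a : E) :
    ω (C.smul lam a) = lam * ω a := by
  have approx : ∀ n : ℕ, |ω (C.smul lam a) - lam * ω a| ≤ 1 / ((n : ℝ) + 1) := fun n => by
    set N : ℝ := (n : ℝ) + 1 with hN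
    have hNpos : 0 < N := by positivity
    set t : ℝ := 1 / N with ht
    have ht0 : 0 ≤ t := by positivity
    have hNt : N * t = 1 := mul_one_div_cancel hNpos.ne'
    have hinv : N * ω (C.smul t a) = ω a := by
      have h := hω.map_natCast_mul_smul a ht0 (n + 1) (by push_cast; exact hNt.le)
      push_cast at h
      rw [← hN, hNt, C.one_smul] at h
      exact h.symm
    have hta : ω (C.smul t a) = t * ω a := by
      rw [← hinv, ← mul_assoc, mul_comm t, hNt, one_mul]
    set k := ⌊lam * N⌋₊
    have hk : (k : ℝ) ≤ lam * N := Nat.floor_le (by positivity)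
    have hk' : lam * N < k + 1 := Nat.lt_floor_add_one _
    have hlam : lam = lam * N * t := by rw [mul_assoc, hNt, mul_one]
    have hkt : k * t ≤ lam := hlam ▸ mul_le_mul_of_nonneg_right hk ht0
    have hkt' : lam ≤ k * t + t := by
      have := mul_le_mul_of_nonneg_right hk'.le ht0
      rw [← hlam] at this
      linarith
    have hkt0 : 0 ≤ k * t := by positivity
    have hsplit : ω (C.smul lam a) = k * (t * ω a) + ω (C.smul (lam - k * t) a) := by
      rw [← hta, ← hω.map_natCast_mul_smul a ht0 k (hkt.trans h1),
        ← hω.2.2 _ _ (C.perp_smul_self _ _ _ hkt0 (sub_nonneg.2 hkt) (by linarith)),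
        ← C.add_smul _ _ _ hkt0 (sub_nonneg.2 hkt) (by linarith), add_sub_cancel]
    have ht1 : t ≤ 1 := by
      rw [ht, div_le_one hNpos, hN]
      linarith [n.cast_nonneg (α := ℝ)]
    have hrest := hω.mono (C.smul_le_smul a (sub_nonneg.2 hkt)
      (show lam - k * t ≤ t by linarith) ht1)
    have hrest0 := (hω.1 (C.smul (lam - k * t) a)).1
    obtain ⟨ha0, ha1⟩ := hω.1 a
    rw [hta] at hrest
    rw [hsplit, abs_le]
    constructor <;> nlinarith
  have hlim := le_of_tendsto' (tendsto_const_nhds.sub tendsto_one_div_add_atTop_nhds_zero_nat)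
    fun n => sub_nonpos.2 (approx n)
  rw [sub_zero] at hlim
  exact sub_eq_zero.1 (abs_eq_zero.1 (le_antisymm hlim (abs_nonneg _)))

end IsState

/-! ### Spectral decompositions -/

section Spectral

variable {C} {n : ℕ} {a : Fin n → E} {lam : Fin n → ℝ} {b : E}

theorem IsContextFun.perp (ha : C.IsContextFun a) {i j : Fin n} (hij : i ≠ j) :
    C.perp (a i) (a j) := by
  have h := List.pairwise_ofFn.1 ha.2.2.pairwise_perp
  rcases lt_or_gt_of_ne hij with hij | hij
  · exact h hij
  · exact C.perp_comm _ _ (h hij)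

theorem IsState.map_spanRep {ω : E → ℝ} (hω : C.IsState ω) (hb : C.SpanRep a lam b) :
    ω b = ∑ i, lam i * ω (a i) := by
  rw [hω.map_sumList hb.2, List.map_ofFn, List.sum_ofFn]
  exact Finset.sum_congr rfl fun i _ => hω.map_smul (hb.1 i).1 (hb.1 i).2 (a i)

theorem IsState.sum_context {ω : E → ℝ} (hω : C.IsState ω) (ha : C.IsContextFun a) :
    ∑ i, ω (a i) = 1 := by
  rw [← hω.2.1, hω.map_sumList ha.2.2, List.map_ofFn, List.sum_ofFn]
  rfl

theorem SpanRep.mem_spectrum (hSU : C.StateUnique) (ha : C.IsContextFun a)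
    (hb : C.SpanRep a lam b) (i : Fin n) : lam i ∈ C.spectrum b := by
  obtain ⟨ω, ⟨hω, hωa⟩, -⟩ := hSU _ (ha.2.1 i)
  refine ⟨a i, ω, ha.2.1 i, hb.2.seq_comm fun x hx => ?_, hω, hωa, ?_⟩
  · obtain ⟨j, rfl⟩ := (List.mem_ofFn' _ _).1 hx
    refine C.seq_smul_comm (hb.1 j).1 (hb.1 j).2 ?_
    rcases eq_or_ne i j with rfl | hij
    · rfl
    · exact (ha.2.1 i).1.seq_comm_of_perp (ha.perp hij)
  · rw [hω.map_spanRep hb, Finset.sum_eq_single i _ (by simp), hωa, mul_one]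
    intro j _ hji
    have h := hω.add_le_one (ha.perp hji.symm)
    rw [le_antisymm (by linarith) (hω.1 (a j)).1, mul_zero]

theorem Spectral.exists_spanRep_le (hSp : C.Spectral) {M : ℝ}
    (hM : IsGreatest (C.spectrum b) M) :
    ∃ (n : ℕ) (a : Fin n → E) (lam : Fin n → ℝ),
      C.IsContextFun a ∧ C.SpanRep a lam b ∧ ∀ i, lam i ≤ M := by
  obtain ⟨A, -, n, a, lam, ha, -, hb⟩ := hSp.2 b
  exact ⟨n, a, lam, ha, hb, fun i => hM.2 (hb.mem_spectrum hSp.1 ha i)⟩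

theorem exists_state_of_mem_spectrum {M : ℝ} (hM : M ∈ C.spectrum b) :
    ∃ ω : E → ℝ, C.IsState ω ∧ ω b = M := by
  obtain ⟨_, ω, _, _, hω, _, h⟩ := hM
  exact ⟨ω, hω, h.symm⟩

theorem mem_Icc_of_mem_spectrum {M : ℝ} (hM : M ∈ C.spectrum b) : M ∈ Set.Icc (0 : ℝ) 1 := by
  obtain ⟨ω, hω, rfl⟩ := exists_state_of_mem_spectrum hM
  exact hω.1 b

theorem Spectral.state_le (hSp : C.Spectral) {M : ℝ} (hM : IsGreatest (C.spectrum b) M)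
    {ω : E → ℝ} (hω : C.IsState ω) : ω b ≤ M := by
  obtain ⟨n, a, lam, ha, hb, hle⟩ := hSp.exists_spanRep_le hM
  calc ω b = ∑ i, lam i * ω (a i) := hω.map_spanRep hb
    _ ≤ ∑ i, M * ω (a i) :=
        Finset.sum_le_sum fun i _ => mul_le_mul_of_nonneg_right (hle i) (hω.1 _).1
    _ = M := by rw [← Finset.mul_sum, hω.sum_context ha, mul_one]

theorem Spectral.le_smul_one (hSp : C.Spectral) {M : ℝ}
    (hM : IsGreatest (C.spectrum b) M) : C.le b (C.smul M C.one) := by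
  obtain ⟨hM0, hM1⟩ := mem_Icc_of_mem_spectrum hM.1
  obtain ⟨n, a, lam, ha, hb, hle⟩ := hSp.exists_spanRep_le hM
  have h := ha.2.2.map_smul hM0 hM1
  rw [List.map_ofFn] at h
  have hall : List.Forall₂ C.le (List.ofFn fun i => C.smul (lam i) (a i))
      (List.ofFn (C.smul M ∘ a)) := by
    rw [List.forall₂_iff_get]
    refine ⟨by simp, fun i _ _ => ?_⟩
    simpa using C.smul_le_smul _ (hb.1 _).1 (hle _) hM1
  obtain ⟨s, hs, hsle⟩ := SumList.exists_le hall h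
  rwa [hb.2.unique hs]

end Spectral

end COSEA

/-- properties of the norm `‖b‖ = M(b)`. -/
theorem norm_properties {E : Type u} (C : COSEA E)
    (hFD : C.FinDim) (hSp : C.Spectral) :
    -- (i) ‖b‖ is the maximum of ω(b) over states ω
    (∀ b M, IsGreatest (C.spectrum b) M →
      IsGreatest {x | ∃ ω : E → ℝ, C.IsState ω ∧ ω b = x} M) ∧
    -- (ii) subadditivity
    (∀ b1 b2 M1 M2 M12, C.perp b1 b2 → IsGreatest (C.spectrum b1) M1 →
      IsGreatest (C.spectrum b2) M2 →
      IsGreatest (C.spectrum (C.oplus b1 b2)) M12 → M12 ≤ M1 + M2) ∧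
    -- (iii) ‖b‖ = 0 iff b = 0
    (∀ b M, IsGreatest (C.spectrum b) M → (M = 0 ↔ b = C.zero)) ∧
    -- (iv) monotonicity, and a ≤ ‖a‖·1
    (∀ a b Ma Mb, C.le a b → IsGreatest (C.spectrum a) Ma →
      IsGreatest (C.spectrum b) Mb → Ma ≤ Mb) ∧
    (∀ a Ma, IsGreatest (C.spectrum a) Ma → C.le a (C.smul Ma C.one)) ∧
    -- (v) submultiplicativity
    (∀ a b Ma Mb Mab, IsGreatest (C.spectrum a) Ma →
      IsGreatest (C.spectrum b) Mb →
      IsGreatest (C.spectrum (C.seq a b)) Mab → Mab ≤ Ma * Mb) := by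
  have sup := fun {b : E} {M : ℝ} (hM : IsGreatest (C.spectrum b) M) {ω : E → ℝ}
    (hω : C.IsState ω) => hSp.state_le hM hω
  refine ⟨fun b M hM => ⟨COSEA.exists_state_of_mem_spectrum hM.1, ?_⟩, ?_, fun b M hM => ?_,
    ?_, fun a Ma hM => hSp.le_smul_one hM, ?_⟩
  · rintro _ ⟨ω, hω, rfl⟩
    exact sup hM hω
  · intro b1 b2 M1 M2 M12 hp h1 h2 h12
    obtain ⟨ω, hω, rfl⟩ := COSEA.exists_state_of_mem_spectrum h12.1
    rw [hω.2.2 _ _ hp]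
    exact add_le_add (sup h1 hω) (sup h2 hω)
  · constructor
    · rintro rfl
      have h := hSp.le_smul_one hM
      rw [C.zero_smul] at h
      exact C.eq_zero_of_le_zero h
    · rintro rfl
      obtain ⟨ω, hω, rfl⟩ := COSEA.exists_state_of_mem_spectrum hM.1
      exact hω.map_zero
  · intro a b Ma Mb hab ha hb
    obtain ⟨ω, hω, rfl⟩ := COSEA.exists_state_of_mem_spectrum ha.1
    exact (hω.mono hab).trans (sup hb hω)
  · intro a b Ma Mb Mab ha hb hab
    obtain ⟨hb0, hb1⟩ := COSEA.mem_Icc_of_mem_spectrum hb.1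
    obtain ⟨ω, hω, rfl⟩ := COSEA.exists_state_of_mem_spectrum hab.1
    have h := hω.mono (C.seq_le_seq a (hSp.le_smul_one hb))
    rw [C.seq_smul _ _ _ hb0 hb1, C.seq_one, hω.map_smul hb0 hb1] at h
    calc ω (C.seq a b) ≤ Mb * ω a := h
      _ ≤ Mb * Ma := mul_le_mul_of_nonneg_left (sup ha hω) hb0
      _ = Ma * Mb := mul_comm _ _
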